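/- Let Ω ⊂ ℝ² be a bounded smooth domain, g, g̃ Riemannian metrics on Ω, φ : Ω → Ω a diffeomorphism with φ|_{∂Ω} = Id, and λ : Ω → (0,∞) with λ|_{∂Ω} = 1. Assume g = λ φ*g̃, det(g^{-1} g̃∘φ) = 1 to first order on ∂Ω, and q = λ^{-1} φ*q̃ where q = |g|^{1/4} Δ_g(|g|^{-1/4}) and q̃ = |g̃|^{1/4} Δ_{g̃}(|g̃|^{-1/4}). Then J_φ λ = 1 on Ω, where J_φ is the Jacobian determinant of φ. -/

import Mathlib

noncomputable section
open Matrix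

/-- Partial derivative in the `i`-th coordinate direction. -/
def pd (i : Fin 2) (f : (Fin 2 → ℝ) → ℝ) (x : Fin 2 → ℝ) : ℝ :=
  fderiv ℝ f x (Pi.single i 1)

/-- Laplace–Beltrami operator of the metric (matrix field) `g`. -/
def lap (g : (Fin 2 → ℝ) → Matrix (Fin 2) (Fin 2) ℝ)
    (f : (Fin 2 → ℝ) → ℝ) (x : Fin 2 → ℝ) : ℝ :=
  (Real.sqrt (g x).det)⁻¹ *
    ∑ a, pd a (fun y => Real.sqrt (g y).det * ∑ b, (g y)⁻¹ a b * pd b f y) x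

/-- Jacobian matrix `Dφ(x)`. -/
def jac (φ : (Fin 2 → ℝ) → (Fin 2 → ℝ)) (x : Fin 2 → ℝ) : Matrix (Fin 2) (Fin 2) ℝ :=
  Matrix.of fun i j => fderiv ℝ (fun y => φ y i) x (Pi.single j 1)

/-- The potential `q = |g|^{1/4} Δ_g(|g|^{-1/4})`. -/
def pot (g : (Fin 2 → ℝ) → Matrix (Fin 2) (Fin 2) ℝ) (x : Fin 2 → ℝ) : ℝ :=
  (g x).det ^ ((1 : ℝ)/4) * lap g (fun y => (g y).det ^ (-(1 : ℝ)/4)) x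


open scoped ContDiff Topology

lemma pd_add {i : Fin 2} {f h : (Fin 2 → ℝ) → ℝ} {x : Fin 2 → ℝ}
    (hf : DifferentiableAt ℝ f x) (hh : DifferentiableAt ℝ h x) :
    pd i (fun y => f y + h y) x = pd i f x + pd i h x := by
  simp [pd, fderiv_fun_add hf hh]

lemma pd_sub {i : Fin 2} {f h : (Fin 2 → ℝ) → ℝ} {x : Fin 2 → ℝ}
    (hf : DifferentiableAt ℝ f x) (hh : DifferentiableAt ℝ h x) :
    pd i (fun y => f y - h y) x = pd i f x - pd i h x := by
  simp [pd, fderiv_fun_sub hf hh]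

lemma pd_neg {i : Fin 2} {f : (Fin 2 → ℝ) → ℝ} {x : Fin 2 → ℝ} :
    pd i (fun y => -f y) x = -pd i f x := by
  simp [pd, fderiv_fun_neg]

lemma pd_mul {i : Fin 2} {f h : (Fin 2 → ℝ) → ℝ} {x : Fin 2 → ℝ}
    (hf : DifferentiableAt ℝ f x) (hh : DifferentiableAt ℝ h x) :
    pd i (fun y => f y * h y) x = f x * pd i h x + pd i f x * h x := by
  simp [pd, fderiv_fun_mul hf hh]; ring

lemma pd_coord (i j : Fin 2) (x : Fin 2 → ℝ) :
    pd i (fun y => y j) x = if i = j then 1 else 0 := by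
  have : fderiv ℝ (fun y : Fin 2 → ℝ => y j) x = ContinuousLinearMap.proj j :=
    (ContinuousLinearMap.proj (R := ℝ) (φ := fun _ : Fin 2 => ℝ) j).fderiv
  simp [pd, this, Pi.single_apply, eq_comm]

lemma pd_congr {i : Fin 2} {f h : (Fin 2 → ℝ) → ℝ} {x : Fin 2 → ℝ} (e : f =ᶠ[𝓝 x] h) :
    pd i f x = pd i h x := by
  simp [pd, e.fderiv_eq]

lemma fderiv_apply_eq_pd (f : (Fin 2 → ℝ) → ℝ) (x v : Fin 2 → ℝ) :
    fderiv ℝ f x v = v 0 * pd 0 f x + v 1 * pd 1 f x := by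
  have : v = v 0 • (Pi.single 0 1 : Fin 2 → ℝ) + v 1 • (Pi.single 1 1 : Fin 2 → ℝ) := by
    ext i; fin_cases i <;> simp
  conv_lhs => rw [this]
  rw [map_add, map_smul, map_smul]; rfl

/-- The chain rule in coordinates. -/
lemma pd_comp {i : Fin 2} {f : (Fin 2 → ℝ) → ℝ} {φ : (Fin 2 → ℝ) → (Fin 2 → ℝ)}
    {x : Fin 2 → ℝ} (hf : DifferentiableAt ℝ f (φ x)) (hφ : DifferentiableAt ℝ φ x) :
    pd i (fun y => f (φ y)) x =
      pd 0 f (φ x) * pd i (fun y => φ y 0) x + pd 1 f (φ x) * pd i (fun y => φ y 1) x := by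
  have h1 : fderiv ℝ (fun y => f (φ y)) x = (fderiv ℝ f (φ x)).comp (fderiv ℝ φ x) :=
    fderiv_comp x hf hφ
  have h2 : ∀ j, pd i (fun y => φ y j) x = fderiv ℝ φ x (Pi.single i 1) j := fun j => by
    rw [pd, fderiv_apply hφ]; rfl
  rw [pd, h1, ContinuousLinearMap.comp_apply, fderiv_apply_eq_pd, h2, h2]; ring

lemma ContDiffAt.pd {i : Fin 2} {f : (Fin 2 → ℝ) → ℝ} {x : Fin 2 → ℝ} (hf : ContDiffAt ℝ ∞ f x) :
    ContDiffAt ℝ ∞ (pd i f) x :=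
  (hf.fderiv_right (m := ∞) (by simp)).clm_apply contDiffAt_const

lemma ContDiff.pd {i : Fin 2} {f : (Fin 2 → ℝ) → ℝ} (hf : ContDiff ℝ ∞ f) :
    ContDiff ℝ ∞ (pd i f) :=
  contDiff_iff_contDiffAt.2 fun _ => hf.contDiffAt.pd

lemma pd_comm {f : (Fin 2 → ℝ) → ℝ} {x : Fin 2 → ℝ} (hf : ContDiffAt ℝ ∞ f x) (i j : Fin 2) :
    pd i (pd j f) x = pd j (pd i f) x := by
  have hd : DifferentiableAt ℝ (fderiv ℝ f) x :=
    (hf.fderiv_right (m := ∞) (by simp)).differentiableAt (by simp)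
  have h : ∀ i j : Fin 2, pd i (pd j f) x =
      fderiv ℝ (fderiv ℝ f) x (Pi.single i 1) (Pi.single j 1) := fun i j => by
    change fderiv ℝ (fun y => fderiv ℝ f y (Pi.single j 1)) x (Pi.single i 1) = _
    rw [fderiv_clm_apply hd (differentiableAt_const _)]
    simp
  rw [h, h]
  exact (hf.isSymmSndFDerivAt (by simp; exact WithTop.coe_le_coe.2 le_top)) _ _

/-- At a local maximum of a function of one variable, the second derivative is nonpositive. -/
lemma IsLocalMax.deriv_deriv_nonpos {f : ℝ → ℝ} {a : ℝ} (h : IsLocalMax f a)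
    (hc : ContinuousAt f a) : deriv (deriv f) a ≤ 0 := by
  by_contra! hpos
  have hmin := isLocalMin_of_deriv_deriv_pos hpos h.deriv_eq_zero hc
  have hconst : f =ᶠ[𝓝 a] fun _ => f a := by
    filter_upwards [h, hmin] with y h1 h2 using le_antisymm h1 h2
  have h1 : deriv f =ᶠ[𝓝 a] fun _ => 0 := by
    filter_upwards [hconst.deriv] with y hy
    simpa using hy
  simp [h1.deriv_eq] at hpos

lemma IsLocalMax.pd_eq_zero {f : (Fin 2 → ℝ) → ℝ} {x : Fin 2 → ℝ} (h : IsLocalMax f x)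
    (i : Fin 2) : pd i f x = 0 := by
  simp [pd, h.fderiv_eq_zero]

/-- At a local maximum the Hessian is negative semidefinite. -/
lemma IsLocalMax.hessian_nonpos {f : (Fin 2 → ℝ) → ℝ} {x : Fin 2 → ℝ} (h : IsLocalMax f x)
    (hf : ContDiffAt ℝ ∞ f x) (v : Fin 2 → ℝ) :
    v 0 * v 0 * pd 0 (pd 0 f) x + 2 * (v 0 * v 1) * pd 0 (pd 1 f) x
      + v 1 * v 1 * pd 1 (pd 1 f) x ≤ 0 := by
  set l : ℝ → (Fin 2 → ℝ) := fun t => x + t • v with hl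
  have hl0 : l 0 = x := by simp [hl]
  have hlc : Continuous l := by fun_prop
  have hld : ∀ t, HasDerivAt l v t := fun t => by
    have h := ((hasDerivAt_id t).smul_const v).const_add x
    rwa [one_smul] at h
  have hdir : ∀ (F : (Fin 2 → ℝ) → ℝ) (t : ℝ), DifferentiableAt ℝ F (l t) →
      deriv (fun s => F (l s)) t = v 0 * pd 0 F (l t) + v 1 * pd 1 F (l t) := fun F t hF => by
    rw [← fderiv_apply_eq_pd]
    exact (hF.hasFDerivAt.comp_hasDerivAt t (hld t)).deriv
  have hten : Filter.Tendsto l (𝓝 0) (𝓝 x) := by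
    simpa [hl0] using hlc.tendsto 0
  have hmax : IsLocalMax (fun t => f (l t)) 0 := by
    have := hten.eventually h
    simpa [IsLocalMax, IsMaxFilter, hl0] using this
  have hcont : ContinuousAt (fun t => f (l t)) 0 :=
    ContinuousAt.comp (by rw [hl0]; exact hf.continuousAt) hlc.continuousAt
  have hev : ∀ᶠ y in 𝓝 x, DifferentiableAt ℝ f y := by
    have := (hf.of_le (m := 1) (by exact_mod_cast le_top)).eventually (by simp)
    exact this.mono fun y hy => hy.differentiableAt (by simp)
  have h1 : deriv (fun t => f (l t)) =ᶠ[𝓝 0]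
      fun t => (fun y => v 0 * pd 0 f y + v 1 * pd 1 f y) (l t) := by
    filter_upwards [hten.eventually hev] with t ht using hdir f t ht
  have hp : ∀ i, DifferentiableAt ℝ (pd i f) x := fun i => hf.pd.differentiableAt (by simp)
  have h2 := hmax.deriv_deriv_nonpos hcont
  have hcm : ∀ i j : Fin 2, pd i (fun y => v j * pd j f y) x = v j * pd i (pd j f) x :=
    fun i j => by
      rw [pd_mul (differentiableAt_const _) (hp j)]
      simp [pd]
  rw [h1.deriv_eq, hdir (fun y => v 0 * pd 0 f y + v 1 * pd 1 f y) 0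
    (by rw [hl0]; exact ((hp 0).const_mul _).add ((hp 1).const_mul _)),
    hl0, pd_add ((hp 0).const_mul _) ((hp 1).const_mul _),
    pd_add ((hp 0).const_mul _) ((hp 1).const_mul _), hcm, hcm, hcm, hcm,
    pd_comm hf 1 0] at h2
  linarith

/-- The weak maximum principle for `∑ Mᵃᵇ ∂ₐ∂_b w + ∑ cᵃ ∂ₐ w`. -/
lemma weak_maximum_principle {Ω : Set (Fin 2 → ℝ)} (hΩ : IsOpen Ω)
    (hΩb : Bornology.IsBounded Ω) {a b d c₀ c₁ w : (Fin 2 → ℝ) → ℝ}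
    (ha : Continuous a) (hc₀ : Continuous c₀)
    (hapos : ∀ x, 0 < a x) (hdet : ∀ x, 0 < a x * d x - b x * b x)
    (hw : ContinuousOn w (closure Ω)) (hws : ∀ x ∈ Ω, ContDiffAt ℝ ∞ w x)
    (heq : ∀ x ∈ Ω, a x * pd 0 (pd 0 w) x + 2 * b x * pd 0 (pd 1 w) x + d x * pd 1 (pd 1 w) x
      + c₀ x * pd 0 w x + c₁ x * pd 1 w x = 0)
    {m : ℝ} (hbd : ∀ x ∈ frontier Ω, w x ≤ m) : ∀ x ∈ Ω, w x ≤ m := by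
  intro x₀ hx₀
  by_contra! hgt
  have hcpt : IsCompact (closure Ω) := hΩb.isCompact_closure
  obtain ⟨k, hk⟩ : ∃ k : ℝ, ∀ x ∈ closure Ω, |c₀ x| / a x < k := by
    obtain ⟨C, hC⟩ := hcpt.bddAbove_image
      (f := fun x => |c₀ x| / a x) (hc₀.abs.div ha fun x => (hapos x).ne').continuousOn
    exact ⟨C + 1, fun x hx => by linarith [hC ⟨x, hx, rfl⟩]⟩
  have hk0 : 0 < k := lt_of_le_of_lt (div_nonneg (abs_nonneg _) (hapos x₀).le)
    (hk x₀ (subset_closure hx₀))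
  set E : (Fin 2 → ℝ) → ℝ := fun x => Real.exp (k * x 0) with hE
  have hEs : ContDiff ℝ ∞ E := by fun_prop
  obtain ⟨B, hB⟩ := hcpt.bddAbove_image (f := E) hEs.continuous.continuousOn
  have hBE : ∀ x ∈ closure Ω, E x ≤ B := fun x hx => hB ⟨x, hx, rfl⟩
  have hB0 : 0 < B := lt_of_lt_of_le (Real.exp_pos _) (hBE x₀ (subset_closure hx₀))
  obtain ⟨ε, hε, hεB⟩ : ∃ ε : ℝ, 0 < ε ∧ ε * B < w x₀ - m :=
    ⟨(w x₀ - m) / (2 * B), by apply div_pos <;> linarith, by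
      have : (w x₀ - m) / (2 * B) * B = (w x₀ - m) / 2 := by field_simp
      linarith⟩
  set u : (Fin 2 → ℝ) → ℝ := fun x => w x + ε * E x with hu
  obtain ⟨y, hy, hymax⟩ := hcpt.exists_isMaxOn ⟨x₀, subset_closure hx₀⟩
    (f := u) (hw.add (continuousOn_const.mul hEs.continuous.continuousOn))
  have hxy : u x₀ ≤ u y := hymax (subset_closure hx₀)
  have hyΩ : y ∈ Ω := by
    by_contra hyn
    have h1 := hbd y ⟨hy, by rwa [hΩ.interior_eq]⟩
    have h2 : ε * E y ≤ ε * B := mul_le_mul_of_nonneg_left (hBE y hy) hε.le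
    have h3 : 0 < ε * E x₀ := mul_pos hε (Real.exp_pos _)
    simp only [hu] at hxy
    linarith
  have hloc : IsLocalMax u y := by
    filter_upwards [hΩ.mem_nhds hyΩ] with z hz using hymax (subset_closure hz)
  have hus : ∀ z ∈ Ω, ContDiffAt ℝ ∞ u z := fun z hz =>
    (hws z hz).add (contDiffAt_const.mul hEs.contDiffAt)
  have hE0 : ∀ z, pd 0 E z = k * E z := fun z => by
    have h := ((hasFDerivAt_apply (𝕜 := ℝ) (0 : Fin 2) z).const_mul k).exp.fderiv
    simp only [pd, hE]
    rw [h]; simp; ring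
  have hE1 : ∀ z, pd 1 E z = 0 := fun z => by
    have h := ((hasFDerivAt_apply (𝕜 := ℝ) (0 : Fin 2) z).const_mul k).exp.fderiv
    simp only [pd, hE]
    rw [h]; simp
  have hup : ∀ i, ∀ z ∈ Ω, pd i u z = pd i w z + ε * pd i E z := fun i z hz => by
    have hd : DifferentiableAt ℝ E z := hEs.contDiffAt.differentiableAt (by simp)
    rw [hu, pd_add ((hws z hz).differentiableAt (by simp)) (hd.const_mul _),
      pd_mul (differentiableAt_const _) hd]
    simp [pd]
  have hupp : ∀ i j, pd i (pd j u) y = pd i (pd j w) y + ε * pd i (pd j E) y := fun i j => by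
    have hev : pd j u =ᶠ[𝓝 y] fun z => pd j w z + ε * pd j E z := by
      filter_upwards [hΩ.mem_nhds hyΩ] with z hz using hup j z hz
    have hd : DifferentiableAt ℝ (pd j E) y := hEs.pd.contDiffAt.differentiableAt (by simp)
    rw [pd_congr hev, pd_add ((hws y hyΩ).pd.differentiableAt (by simp)) (hd.const_mul _),
      pd_mul (differentiableAt_const _) hd]
    simp [pd]
  have hE1' : pd 1 E = fun _ => 0 := funext hE1
  have hE0' : pd 0 E = fun z => k * E z := funext hE0
  have hE00 : pd 0 (pd 0 E) y = k * (k * E y) := by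
    rw [hE0', pd_mul (differentiableAt_const _) (hEs.contDiffAt.differentiableAt (by simp)), hE0]
    simp [pd]
  have hz : ∀ i, pd i (fun _ => (0 : ℝ)) y = 0 := fun i => by simp [pd]
  have g0 := hloc.pd_eq_zero 0
  have g1 := hloc.pd_eq_zero 1
  rw [hup _ y hyΩ, hE0] at g0
  rw [hup _ y hyΩ, hE1] at g1
  have q1 := hloc.hessian_nonpos (hus y hyΩ) ![1, b y / a y]
  have q2 := hloc.hessian_nonpos (hus y hyΩ) ![0, 1]
  simp only [Matrix.cons_val_zero, Matrix.cons_val_one, hupp, hE1', hE00, hz] at q1 q2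
  have hay := hapos y
  have e := heq y hyΩ
  have key : 0 < a y * k + c₀ y := by
    have := (div_lt_iff₀ hay).1 (hk y hy)
    linarith [neg_abs_le (c₀ y)]
  have hEy : 0 < E y := Real.exp_pos _
  set H00 := pd 0 (pd 0 w) y
  set H01 := pd 0 (pd 1 w) y
  set H11 := pd 1 (pd 1 w) y
  have q1' := mul_nonpos_of_nonneg_of_nonpos hay.le q1
  have q2' := mul_nonpos_of_nonneg_of_nonpos (div_pos (hdet y) hay).le q2
  have hid : a y * H00 + 2 * b y * H01 + d y * H11 + ε * (a y * (k * (k * E y))) ≤ 0 := by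
    refine le_trans (le_of_eq ?_) (add_nonpos q1' q2')
    field_simp
    ring
  have h0 : pd 0 w y = - (ε * (k * E y)) := by linarith
  have h1 : pd 1 w y = 0 := by linarith
  rw [h0, h1] at e
  have : 0 < ε * k * E y * (a y * k + c₀ y) := by positivity
  nlinarith

lemma integral_pd_eq_zero {V : (Fin 2 → ℝ) → ℝ} (hV : ContDiff ℝ ∞ V) (hc : HasCompactSupport V)
    (i : Fin 2) : ∫ x, pd i V x = 0 := by
  obtain ⟨D, hD⟩ := (hV.of_le (m := 1) (by exact_mod_cast le_top)).lipschitzWith_of_hasCompactSupport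
    hc (by simp)
  have h := (LipschitzWith.const (1 : ℝ)).integral_lineDeriv_mul_eq (μ := MeasureTheory.volume)
    hD hc (-(Pi.single i 1 : Fin 2 → ℝ))
  have h1 : ∀ x, lineDeriv ℝ V x (Pi.single i 1) = pd i V x := fun x =>
    (hV.contDiffAt.differentiableAt (by simp)).lineDeriv_eq_fderiv
  have h0 : ∀ x v, lineDeriv ℝ (fun _ : Fin 2 → ℝ => (1 : ℝ)) x v = 0 := by simp [lineDeriv]
  simpa [h1, h0] using h.symm

lemma jac_apply (φ : (Fin 2 → ℝ) → (Fin 2 → ℝ)) (x : Fin 2 → ℝ) (i j : Fin 2) :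
    jac φ x i j = pd j (fun y => φ y i) x := rfl

lemma jac_det (φ : (Fin 2 → ℝ) → (Fin 2 → ℝ)) (x : Fin 2 → ℝ) :
    (jac φ x).det = pd 0 (fun y => φ y 0) x * pd 1 (fun y => φ y 1) x
      - pd 1 (fun y => φ y 0) x * pd 0 (fun y => φ y 1) x := by
  rw [Matrix.det_fin_two]; rfl

lemma jac_congr {φ ψ : (Fin 2 → ℝ) → (Fin 2 → ℝ)} {x : Fin 2 → ℝ} (h : φ =ᶠ[𝓝 x] ψ) :
    jac φ x = jac ψ x := by
  ext i j
  exact pd_congr (h.mono fun y hy => by simp [hy])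

/-- A map equal to the identity off a compact set preserves the integral of `∂₀P`, in the sense
that `∂₀P ∘ φ · det Dφ - ∂₀P` is a compactly supported null Lagrangian. -/
lemma pd_comp_mul_jac_det_sub {φ : (Fin 2 → ℝ) → (Fin 2 → ℝ)} (hφ : ContDiff ℝ ∞ φ)
    {K : Set (Fin 2 → ℝ)} (hK : IsCompact K) (hid : ∀ x ∉ K, φ x = x)
    {P : (Fin 2 → ℝ) → ℝ} (hP : ContDiff ℝ ∞ P) :
    HasCompactSupport (fun x => pd 0 P (φ x) * (jac φ x).det - pd 0 P x) ∧
      ∫ x, (pd 0 P (φ x) * (jac φ x).det - pd 0 P x) = 0 := by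
  have hev : ∀ x ∉ K, φ =ᶠ[𝓝 x] fun y => y := fun x hx => by
    filter_upwards [hK.isClosed.isOpen_compl.mem_nhds hx] with y hy using hid y hy
  have hpdφ : ∀ x ∉ K, ∀ i j, pd i (fun y => φ y j) x = if i = j then 1 else 0 :=
    fun x hx i j => by
      rw [← pd_coord i j x]
      exact pd_congr ((hev x hx).mono fun y hy => by simp [hy])
  refine ⟨HasCompactSupport.intro hK fun x hx => ?_, ?_⟩
  · rw [jac_det]; simp [hpdφ x hx, hid x hx]
  have hφi : ∀ i, ContDiff ℝ ∞ (fun y => φ y i) := fun i => contDiff_pi.1 hφ i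
  have hPφ : ContDiff ℝ ∞ (fun y => P (φ y)) := hP.comp hφ
  set V₁ : (Fin 2 → ℝ) → ℝ := fun x => P (φ x) * pd 1 (fun y => φ y 1) x - P x with hV₁
  set V₂ : (Fin 2 → ℝ) → ℝ := fun x => P (φ x) * pd 0 (fun y => φ y 1) x with hV₂
  have hs₁ : ContDiff ℝ ∞ V₁ := (hPφ.mul (hφi 1).pd).sub hP
  have hs₂ : ContDiff ℝ ∞ V₂ := hPφ.mul (hφi 1).pd
  have hc₁ : HasCompactSupport V₁ := HasCompactSupport.intro hK fun x hx => by
    simp [hV₁, hpdφ x hx, hid x hx]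
  have hc₂ : HasCompactSupport V₂ := HasCompactSupport.intro hK fun x hx => by
    simp [hV₂, hpdφ x hx]
  have hd : ∀ {f : (Fin 2 → ℝ) → ℝ} {x}, ContDiff ℝ ∞ f → DifferentiableAt ℝ f x :=
    fun hf => hf.contDiffAt.differentiableAt (by simp)
  have hdiv : ∀ x, pd 0 P (φ x) * (jac φ x).det - pd 0 P x = pd 0 V₁ x - pd 1 V₂ x := fun x => by
    have hφd : DifferentiableAt ℝ φ x := hφ.contDiffAt.differentiableAt (by simp)
    rw [jac_det, hV₁, hV₂, pd_sub (hd (hPφ.mul (hφi 1).pd)) (hd hP),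
      pd_mul (hd hPφ) (hd (hφi 1).pd), pd_mul (hd hPφ) (hd (hφi 1).pd),
      pd_comp (hd hP) hφd, pd_comp (hd hP) hφd, pd_comm (hφi 1).contDiffAt 0 1]
    ring
  have hint : ∀ {V : (Fin 2 → ℝ) → ℝ} (i), ContDiff ℝ ∞ V → HasCompactSupport V →
      MeasureTheory.Integrable (pd i V) := fun i hV hc => by
    refine hV.pd.continuous.integrable_of_hasCompactSupport ?_
    exact (hc.fderiv ℝ).comp_left (g := fun L : (Fin 2 → ℝ) →L[ℝ] ℝ => L (Pi.single i 1)) rfl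
  simp_rw [hdiv]
  rw [MeasureTheory.integral_sub (hint 0 hs₁ hc₁) (hint 1 hs₂ hc₂),
    integral_pd_eq_zero hs₁ hc₁, integral_pd_eq_zero hs₂ hc₂, sub_zero]

/-- A smooth potential whose `∂₀` derivative is a bump function in a given ball. -/
lemma exists_pd_bump (y₀ : Fin 2 → ℝ) {r : ℝ} (hr : 0 < r) :
    ∃ P : (Fin 2 → ℝ) → ℝ, ContDiff ℝ ∞ P ∧ (∀ y, 0 ≤ pd 0 P y) ∧ 0 < pd 0 P y₀ ∧
      ∀ y, pd 0 P y ≠ 0 → dist y y₀ < r := by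
  have hb : ∀ c : ℝ, ∃ b : ℝ → ℝ, ContDiff ℝ ∞ b ∧ (∀ t, 0 ≤ b t) ∧ 0 < b c ∧
      ∀ t, b t ≠ 0 → dist t c < r := fun c => by
    let b : ContDiffBump c := ⟨r / 2, r, by positivity, by linarith⟩
    refine ⟨b, b.contDiff, fun t => b.nonneg, b.pos_of_mem_ball (by simp [b, hr]), fun t ht => ?_⟩
    have : t ∈ Function.support b := ht
    rwa [b.support_eq] at this
  obtain ⟨b₀, hs₀, hn₀, hp₀, hd₀⟩ := hb (y₀ 0)
  obtain ⟨b₁, hs₁, hn₁, hp₁, hd₁⟩ := hb (y₀ 1)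
  set T : ℝ → ℝ := fun t => ∫ s in (0 : ℝ)..t, b₀ s with hT
  have hTd : ∀ t, HasDerivAt T (b₀ t) t := fun t =>
    (hs₀.continuous.integral_hasStrictDerivAt 0 t).hasDerivAt
  have hTs : ContDiff ℝ ∞ T := by
    rw [contDiff_infty_iff_deriv]
    refine ⟨fun t => (hTd t).differentiableAt, ?_⟩
    rwa [show deriv T = b₀ from funext fun t => (hTd t).deriv]
  set P : (Fin 2 → ℝ) → ℝ := fun y => T (y 0) * b₁ (y 1) with hP
  have hPd : ∀ y, pd 0 P y = b₀ (y 0) * b₁ (y 1) := fun y => by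
    have h0 :=
      (hTd (y 0)).comp_hasFDerivAt y (hasFDerivAt_apply (𝕜 := ℝ) (0 : Fin 2) y)
    have h1 :=
      (hs₁.contDiffAt (x := y 1).differentiableAt (by simp)).hasDerivAt.comp_hasFDerivAt y
        (hasFDerivAt_apply (𝕜 := ℝ) (1 : Fin 2) y)
    have h2 : fderiv ℝ P y = _ := (h0.mul h1).fderiv
    rw [pd, h2]
    simp; ring
  refine ⟨P, by fun_prop, fun y => ?_, ?_, fun y hy => ?_⟩
  · rw [hPd]; exact mul_nonneg (hn₀ _) (hn₁ _)
  · rw [hPd]; exact mul_pos hp₀ hp₁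
  · rw [hPd] at hy
    rw [dist_pi_lt_iff hr, Fin.forall_fin_two]
    exact ⟨hd₀ _ (left_ne_zero_of_mul hy), hd₁ _ (right_ne_zero_of_mul hy)⟩

/-- A smooth self-map of the plane equal to the identity off a compact set cannot be orientation
reversing over a ball. -/
lemma exists_jac_det_pos {φ : (Fin 2 → ℝ) → (Fin 2 → ℝ)} (hφ : ContDiff ℝ ∞ φ)
    {K : Set (Fin 2 → ℝ)} (hK : IsCompact K) (hid : ∀ x ∉ K, φ x = x)
    (y₀ : Fin 2 → ℝ) {r : ℝ} (hr : 0 < r) :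
    ∃ x, dist (φ x) y₀ < r ∧ 0 < (jac φ x).det := by
  by_contra! hneg
  obtain ⟨P, hP, hP0, hPy, hPr⟩ := exists_pd_bump y₀ hr
  obtain ⟨hc, hint⟩ := pd_comp_mul_jac_det_sub hφ hK hid hP
  set F := fun x => pd 0 P (φ x) * (jac φ x).det - pd 0 P x with hF
  have hle : ∀ x, pd 0 P (φ x) * (jac φ x).det ≤ 0 := fun x => by
    by_cases h : pd 0 P (φ x) = 0
    · simp [h]
    · exact mul_nonpos_of_nonneg_of_nonpos (hP0 _) (hneg x (hPr _ h))
  have hφi : ∀ i, ContDiff ℝ ∞ (fun y => φ y i) := fun i => contDiff_pi.1 hφ i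
  have hFc : Continuous F := by
    have h1 : Continuous fun x => pd 0 P (φ x) := hP.pd.continuous.comp hφ.continuous
    have h2 : ∀ i j, Continuous (pd i (fun y => φ y j)) := fun i j => (hφi j).pd.continuous
    simp only [hF, jac_det]
    exact (h1.mul (((h2 _ _).mul (h2 _ _)).sub ((h2 _ _).mul (h2 _ _)))).sub hP.pd.continuous
  have hpos : 0 < ∫ x, -F x := hFc.neg.integral_pos_of_hasCompactSupport_nonneg_nonzero
    (x := y₀) hc.neg (fun x => by simp only [hF, Pi.zero_apply]; linarith [hle x, hP0 x])
    (by simp only [hF]; linarith [hle y₀])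
  rw [MeasureTheory.integral_neg, hint] at hpos
  simp at hpos

/-- A map of a bounded domain fixing the boundary pointwise cannot reverse orientation everywhere. -/
lemma exists_jac_det_pos_of_eq_on_frontier {Ω : Set (Fin 2 → ℝ)} (hΩ : IsOpen Ω)
    (hΩb : Bornology.IsBounded Ω) (hne : Ω.Nonempty) {φ : (Fin 2 → ℝ) → (Fin 2 → ℝ)}
    (hφc : ContinuousOn φ (closure Ω)) (hφ : ∀ x ∈ Ω, ContDiffAt ℝ ∞ φ x)
    (hbd : ∀ x ∈ frontier Ω, φ x = x) : ∃ x ∈ Ω, 0 < (jac φ x).det := by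
  obtain ⟨y₀, hy₀⟩ := hne
  have hcpt : IsCompact (closure Ω) := hΩb.isCompact_closure
  obtain ⟨R, hR, hball⟩ := Metric.isOpen_iff.1 hΩ y₀ hy₀
  set r := R / 3 with hr
  have hr0 : 0 < r := by positivity
  set ψ : (Fin 2 → ℝ) → (Fin 2 → ℝ) := fun x => φ x - x with hψ
  have hψc : ContinuousOn ψ (closure Ω) := hφc.sub continuousOn_id
  set K : Set (Fin 2 → ℝ) :=
    (closure Ω ∩ (fun x => ‖ψ x‖) ⁻¹' Set.Ici r) ∪ Metric.closedBall y₀ (2 * r) with hKdef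
  have hKcl : IsClosed K :=
    (hψc.norm.preimage_isClosed_of_isClosed isClosed_closure isClosed_Ici).union
      Metric.isClosed_closedBall
  have hKΩ : K ⊆ Ω := by
    rintro x (⟨hx, hxr⟩ | hx)
    · by_contra hxn
      have := hbd x ⟨hx, by rwa [hΩ.interior_eq]⟩
      simp [hψ, this] at hxr
      linarith
    · exact hball (Metric.mem_ball.2 (lt_of_le_of_lt (Metric.mem_closedBall.1 hx) (by linarith)))
  obtain ⟨η, hη0, hη1, hη⟩ := exists_contMDiffMap_zero_one_nhds_of_isClosed
    (n := (⊤ : ℕ∞)) (modelWithCornersSelf ℝ (Fin 2 → ℝ)) hΩ.isClosed_compl hKcl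
    (Set.disjoint_left.2 fun x hx hxK => hx (hKΩ hxK))
  have hηs : ContDiff ℝ ∞ η := η.contMDiff.contDiff
  set Φ : (Fin 2 → ℝ) → (Fin 2 → ℝ) := fun x => x + η x • ψ x with hΦ
  have hout : ∀ x ∉ Ω, Φ =ᶠ[𝓝 x] fun y => y := fun x hx => by
    filter_upwards [hη0.filter_mono (nhds_le_nhdsSet (show x ∈ Ωᶜ from hx))] with y hy
    simp [hΦ, hy]
  have hΦs : ContDiff ℝ ∞ Φ := contDiff_iff_contDiffAt.2 fun x => by
    by_cases hx : x ∈ Ω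
    · exact contDiffAt_id.add (hηs.contDiffAt.smul ((hφ x hx).sub contDiffAt_id))
    · exact contDiffAt_id.congr_of_eventuallyEq (hout x hx)
  obtain ⟨x, hxr, hxpos⟩ := exists_jac_det_pos hΦs hcpt
    (fun x hx => (hout x fun h => hx (subset_closure h)).eq_of_nhds) y₀ hr0
  have hxK : x ∈ K := by
    by_contra hxn
    have hnb : 2 * r < dist x y₀ := by
      by_contra! h
      exact hxn (Or.inr h)
    by_cases hx : x ∈ Ω
    · have h1 : ‖ψ x‖ < r := by
        by_contra! h
        exact hxn (Or.inl ⟨subset_closure hx, h⟩)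
      have h2 : dist x (Φ x) ≤ ‖ψ x‖ := by
        rw [dist_eq_norm, hΦ]
        simp only [sub_add_cancel_left, norm_neg, norm_smul]
        rw [Real.norm_of_nonneg (hη x).1]
        exact mul_le_of_le_one_left (norm_nonneg _) (hη x).2
      linarith [dist_triangle x (Φ x) y₀]
    · rw [(hout x hx).eq_of_nhds] at hxr
      linarith
  refine ⟨x, hKΩ hxK, ?_⟩
  have hloc : Φ =ᶠ[𝓝 x] φ := by
    filter_upwards [hη1.filter_mono (nhds_le_nhdsSet hxK)] with y hy
    simp [hΦ, hy, hψ]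
  rwa [jac_congr hloc] at hxpos

/-- The density-weighted gradient `√|g| gᵃᵇ ∂_b f`, whose divergence is `√|g| Δ_g f`. -/
def flux (g : (Fin 2 → ℝ) → Matrix (Fin 2) (Fin 2) ℝ) (f : (Fin 2 → ℝ) → ℝ) (a : Fin 2)
    (y : Fin 2 → ℝ) : ℝ :=
  Real.sqrt (g y).det * ∑ b, (g y)⁻¹ a b * pd b f y

section Flux

variable {g : (Fin 2 → ℝ) → Matrix (Fin 2) (Fin 2) ℝ} {f : (Fin 2 → ℝ) → ℝ}

lemma lap_eq_flux (x : Fin 2 → ℝ) :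
    lap g f x = (Real.sqrt (g x).det)⁻¹ * (pd 0 (flux g f 0) x + pd 1 (flux g f 1) x) := by
  rw [lap, Fin.sum_univ_two]; rfl

lemma contDiff_det (hg : ∀ i j, ContDiff ℝ ∞ (fun x => g x i j)) :
    ContDiff ℝ ∞ (fun x => (g x).det) := by
  simp_rw [Matrix.det_fin_two]
  exact ((hg 0 0).mul (hg 1 1)).sub ((hg 0 1).mul (hg 1 0))

lemma contDiff_div_sqrt_det (hg : ∀ i j, ContDiff ℝ ∞ (fun x => g x i j))
    (hpos : ∀ x, (g x).PosDef) (i j : Fin 2) :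
    ContDiff ℝ ∞ (fun x => g x i j / Real.sqrt (g x).det) :=
  (hg i j).div ((contDiff_det hg).sqrt fun x => (hpos x).det_pos.ne')
    fun x => (Real.sqrt_pos.2 (hpos x).det_pos).ne'

lemma sqrt_mul_inv {A : Matrix (Fin 2) (Fin 2) ℝ} (hA : 0 < A.det) (i j : Fin 2) :
    Real.sqrt A.det * A⁻¹ i j = A.adjugate i j / Real.sqrt A.det := by
  have hs := Real.sqrt_pos.2 hA
  have h : A⁻¹ i j = A.det⁻¹ * A.adjugate i j := by
    rw [Matrix.inv_def, Ring.inverse_eq_inv']; rfl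
  rw [h]
  nth_rewrite 2 [← Real.mul_self_sqrt hA.le]
  field_simp

lemma flux_zero {y : Fin 2 → ℝ} (hpos : 0 < (g y).det) :
    flux g f 0 y = g y 1 1 / Real.sqrt (g y).det * pd 0 f y
      - g y 0 1 / Real.sqrt (g y).det * pd 1 f y := by
  rw [flux, Fin.sum_univ_two, mul_add, ← mul_assoc, ← mul_assoc, sqrt_mul_inv hpos,
    sqrt_mul_inv hpos, Matrix.adjugate_fin_two]
  simp; ring

lemma flux_one {y : Fin 2 → ℝ} (hpos : 0 < (g y).det) :
    flux g f 1 y = g y 0 0 / Real.sqrt (g y).det * pd 1 f y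
      - g y 1 0 / Real.sqrt (g y).det * pd 0 f y := by
  rw [flux, Fin.sum_univ_two, mul_add, ← mul_assoc, ← mul_assoc, sqrt_mul_inv hpos,
    sqrt_mul_inv hpos, Matrix.adjugate_fin_two]
  simp; ring

lemma contDiffAt_flux (hg : ∀ i j, ContDiff ℝ ∞ (fun x => g x i j))
    (hpos : ∀ x, (g x).PosDef) {x : Fin 2 → ℝ} (hf : ContDiffAt ℝ ∞ f x) (a : Fin 2) :
    ContDiffAt ℝ ∞ (flux g f a) x := by
  have h := fun i j => (contDiff_div_sqrt_det hg hpos i j).contDiffAt (x := x)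
  fin_cases a
  · exact (((h 1 1).mul hf.pd).sub ((h 0 1).mul hf.pd)).congr_of_eventuallyEq
      (Filter.Eventually.of_forall fun y => flux_zero (hpos y).det_pos)
  · exact (((h 0 0).mul hf.pd).sub ((h 1 0).mul hf.pd)).congr_of_eventuallyEq
      (Filter.Eventually.of_forall fun y => flux_one (hpos y).det_pos)

lemma flux_mul {h : (Fin 2 → ℝ) → ℝ} {x : Fin 2 → ℝ} (hf : DifferentiableAt ℝ f x)
    (hh : DifferentiableAt ℝ h x) (a : Fin 2) :
    flux g (fun y => f y * h y) a x = f x * flux g h a x + h x * flux g f a x := by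
  simp only [flux, Fin.sum_univ_two, pd_mul hf hh]
  ring

end Flux

lemma det_conformal_pullback (l : ℝ) (J A : Matrix (Fin 2) (Fin 2) ℝ) :
    (l • (Jᵀ * A * J)).det = (l * J.det) ^ 2 * A.det := by
  rw [Matrix.det_smul, Matrix.det_mul, Matrix.det_mul, Matrix.det_transpose]
  simp; ring

/-- Covariance of the Laplace–Beltrami operator in dimension two: conformal changes scale it, and
it commutes with pullback. -/
lemma lap_conformal_pullback {Ω : Set (Fin 2 → ℝ)} (hΩ : IsOpen Ω)
    {g gt : (Fin 2 → ℝ) → Matrix (Fin 2) (Fin 2) ℝ}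
    (hgt : ∀ i j, ContDiff ℝ ∞ (fun x => gt x i j))
    (hgtpos : ∀ x, (gt x).PosDef) {φ : (Fin 2 → ℝ) → (Fin 2 → ℝ)}
    (hφ : ∀ x ∈ Ω, ContDiffAt ℝ ∞ φ x) {lam : (Fin 2 → ℝ) → ℝ} (hlam : ∀ x, 0 < lam x)
    (hJ : ∀ x ∈ Ω, 0 < (jac φ x).det)
    (hpull : ∀ x ∈ Ω, g x = lam x • ((jac φ x)ᵀ * gt (φ x) * jac φ x))
    {f : (Fin 2 → ℝ) → ℝ} (hf : ContDiff ℝ ∞ f) {x : Fin 2 → ℝ} (hx : x ∈ Ω) :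
    lap g (fun y => f (φ y)) x = (lam x)⁻¹ * lap gt f (φ x) := by
  have hsqrt : ∀ y ∈ Ω, Real.sqrt (g y).det =
      lam y * (jac φ y).det * Real.sqrt (gt (φ y)).det := fun y hy => by
    rw [hpull y hy, det_conformal_pullback, Real.sqrt_mul (sq_nonneg _),
      Real.sqrt_sq (mul_pos (hlam y) (hJ y hy)).le]
  have hdet : ∀ y ∈ Ω, 0 < (g y).det := fun y hy => by
    rw [hpull y hy, det_conformal_pullback]
    exact mul_pos (pow_pos (mul_pos (hlam y) (hJ y hy)) 2) (hgtpos _).det_pos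
  have hφi : ∀ y ∈ Ω, ∀ i, ContDiffAt ℝ ∞ (fun z => φ z i) y := fun y hy i =>
    contDiffAt_pi.1 (hφ y hy) i
  have hdf : ∀ {h : (Fin 2 → ℝ) → ℝ} {y}, ContDiffAt ℝ ∞ h y → DifferentiableAt ℝ h y :=
    fun h => h.differentiableAt (by simp)
  have hφd : ∀ y ∈ Ω, DifferentiableAt ℝ φ y := fun y hy => (hφ y hy).differentiableAt (by simp)
  have hent : ∀ y ∈ Ω, ∀ i j, g y i j = lam y *
      (pd i (fun z => φ z 0) y * (gt (φ y) 0 0 * pd j (fun z => φ z 0) y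
        + gt (φ y) 0 1 * pd j (fun z => φ z 1) y)
      + pd i (fun z => φ z 1) y * (gt (φ y) 1 0 * pd j (fun z => φ z 0) y
        + gt (φ y) 1 1 * pd j (fun z => φ z 1) y)) := fun y hy i j => by
    rw [hpull y hy]
    simp only [Matrix.smul_apply, Matrix.mul_apply, Fin.sum_univ_two, Matrix.transpose_apply,
      jac_apply, smul_eq_mul]
    ring
  have hfl0 : ∀ y ∈ Ω, flux g (fun z => f (φ z)) 0 y =
      pd 1 (fun z => φ z 1) y * flux gt f 0 (φ y)
        - pd 1 (fun z => φ z 0) y * flux gt f 1 (φ y) := fun y hy => by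
    have hl := hlam y
    have hj := hJ y hy
    have hs := Real.sqrt_pos.2 (hgtpos (φ y)).det_pos
    rw [flux_zero (hdet y hy), flux_zero (hgtpos _).det_pos, flux_one (hgtpos _).det_pos,
      pd_comp (hdf hf.contDiffAt) (hφd y hy), pd_comp (hdf hf.contDiffAt) (hφd y hy),
      hsqrt y hy, hent y hy, hent y hy]
    field_simp
    rw [jac_det]
    ring
  have hfl1 : ∀ y ∈ Ω, flux g (fun z => f (φ z)) 1 y =
      pd 0 (fun z => φ z 0) y * flux gt f 1 (φ y)
        - pd 0 (fun z => φ z 1) y * flux gt f 0 (φ y) := fun y hy => by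
    have hl := hlam y
    have hj := hJ y hy
    have hs := Real.sqrt_pos.2 (hgtpos (φ y)).det_pos
    rw [flux_one (hdet y hy), flux_zero (hgtpos _).det_pos, flux_one (hgtpos _).det_pos,
      pd_comp (hdf hf.contDiffAt) (hφd y hy), pd_comp (hdf hf.contDiffAt) (hφd y hy),
      hsqrt y hy, hent y hy, hent y hy]
    field_simp
    rw [jac_det]
    ring
  have hF : ∀ a, DifferentiableAt ℝ (flux gt f a) (φ x) := fun a =>
    hdf (contDiffAt_flux hgt hgtpos hf.contDiffAt a)
  have hFφ : ∀ a, DifferentiableAt ℝ (fun y => flux gt f a (φ y)) x := fun a =>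
    (hF a).comp x (hφd x hx)
  have hp : ∀ i j, DifferentiableAt ℝ (pd i (fun z => φ z j)) x := fun i j =>
    hdf (hφi x hx j).pd
  have hdiv : pd 0 (flux g (fun z => f (φ z)) 0) x + pd 1 (flux g (fun z => f (φ z)) 1) x =
      (jac φ x).det * (pd 0 (flux gt f 0) (φ x) + pd 1 (flux gt f 1) (φ x)) := by
    have e0 := pd_congr (i := 0) (Filter.eventually_of_mem (hΩ.mem_nhds hx) hfl0)
    have e1 := pd_congr (i := 1) (Filter.eventually_of_mem (hΩ.mem_nhds hx) hfl1)
    rw [e0, e1, pd_sub ((hp _ _).fun_mul (hFφ _)) ((hp _ _).fun_mul (hFφ _)),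
      pd_sub ((hp _ _).fun_mul (hFφ _)) ((hp _ _).fun_mul (hFφ _)), pd_mul (hp _ _) (hFφ _),
      pd_mul (hp _ _) (hFφ _), pd_mul (hp _ _) (hFφ _), pd_mul (hp _ _) (hFφ _),
      pd_comp (hF _) (hφd x hx), pd_comp (hF _) (hφd x hx), pd_comp (hF _) (hφd x hx),
      pd_comp (hF _) (hφd x hx), pd_comm (hφi x hx 0) 1 0, pd_comm (hφi x hx 1) 1 0, jac_det]
    ring
  have hl := hlam x
  have hj := hJ x hx
  have hs := Real.sqrt_pos.2 (hgtpos (φ x)).det_pos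
  rw [lap_eq_flux, lap_eq_flux, hdiv, hsqrt x hx]
  field_simp

/-- Two solutions of the same Schrödinger equation `Δ_g u = V u` with equal boundary values agree
if one of them is positive. -/
lemma eq_of_mul_lap_eq_mul_lap {Ω : Set (Fin 2 → ℝ)} (hΩ : IsOpen Ω)
    (hΩb : Bornology.IsBounded Ω) {g : (Fin 2 → ℝ) → Matrix (Fin 2) (Fin 2) ℝ}
    (hg : ∀ i j, ContDiff ℝ ∞ (fun x => g x i j)) (hgpos : ∀ x, (g x).PosDef)
    {D D' : (Fin 2 → ℝ) → ℝ} (hD : ContDiff ℝ ∞ D) (hDpos : ∀ x, 0 < D x)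
    (hD' : ∀ x ∈ Ω, ContDiffAt ℝ ∞ D' x) (hD'c : ContinuousOn D' (closure Ω))
    (heq : ∀ x ∈ Ω, D' x * lap g D x = D x * lap g D' x)
    (hbd : ∀ x ∈ frontier Ω, D' x = D x) : ∀ x ∈ Ω, D' x = D x := by
  set N : Fin 2 → Fin 2 → (Fin 2 → ℝ) → ℝ := fun i j x => g x i j / Real.sqrt (g x).det with hN
  have hNs : ∀ i j, ContDiff ℝ ∞ (N i j) := contDiff_div_sqrt_det hg hgpos
  have hsym : ∀ x, g x 1 0 = g x 0 1 := fun x => by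
    simpa using (hgpos x).isHermitian.apply 0 1
  have hNsym : N 1 0 = N 0 1 := funext fun x => by simp [hN, hsym]
  set w : (Fin 2 → ℝ) → ℝ := fun x => D' x / D x with hw
  have hws : ∀ x ∈ Ω, ContDiffAt ℝ ∞ w x := fun x hx =>
    (hD' x hx).div hD.contDiffAt (hDpos x).ne'
  have hwc : ContinuousOn w (closure Ω) :=
    hD'c.div hD.continuous.continuousOn fun x _ => (hDpos x).ne'
  have hwD : D' = fun x => w x * D x := funext fun x => by
    simp [hw, (hDpos x).ne']
  have hdf : ∀ {h : (Fin 2 → ℝ) → ℝ} {y}, ContDiffAt ℝ ∞ h y → DifferentiableAt ℝ h y :=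
    fun h => h.differentiableAt (by simp)
  have hfx : ∀ f : (Fin 2 → ℝ) → ℝ, flux g f 0 = fun y => N 1 1 y * pd 0 f y - N 0 1 y * pd 1 f y :=
    fun f => funext fun y => flux_zero (hgpos y).det_pos
  have hfy : ∀ f : (Fin 2 → ℝ) → ℝ, flux g f 1 = fun y => N 0 0 y * pd 1 f y - N 0 1 y * pd 0 f y :=
    fun f => funext fun y => by rw [← hNsym]; exact flux_one (hgpos y).det_pos
  set c₀ : (Fin 2 → ℝ) → ℝ := fun x => pd 0 (N 1 1) x - pd 1 (N 0 1) x
    + 2 * flux g D 0 x / D x with hc₀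
  set c₁ : (Fin 2 → ℝ) → ℝ := fun x => pd 1 (N 0 0) x - pd 0 (N 0 1) x
    + 2 * flux g D 1 x / D x with hc₁
  have hpde : ∀ x ∈ Ω, N 1 1 x * pd 0 (pd 0 w) x + 2 * (-N 0 1 x) * pd 0 (pd 1 w) x
      + N 0 0 x * pd 1 (pd 1 w) x + c₀ x * pd 0 w x + c₁ x * pd 1 w x = 0 := fun x hx => by
    have hDx := hDpos x
    have hs := Real.sqrt_pos.2 (hgpos x).det_pos
    have hflD : ∀ a, DifferentiableAt ℝ (flux g D a) x := fun a =>
      hdf (contDiffAt_flux hg hgpos hD.contDiffAt a)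
    have hflw : ∀ a, DifferentiableAt ℝ (flux g w a) x := fun a =>
      hdf (contDiffAt_flux hg hgpos (hws x hx) a)
    have hDd : DifferentiableAt ℝ D x := hdf hD.contDiffAt
    have hwd : DifferentiableAt ℝ w x := hdf (hws x hx)
    have hprod : ∀ a, pd a (flux g D' a) x = w x * pd a (flux g D a) x + pd a w x * flux g D a x
        + (D x * pd a (flux g w a) x + pd a D x * flux g w a x) := fun a => by
      have hev : flux g D' a =ᶠ[𝓝 x] fun y => w y * flux g D a y + D y * flux g w a y := by
        filter_upwards [hΩ.mem_nhds hx] with y hy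
        rw [hwD, flux_mul (hdf (hws y hy)) (hdf hD.contDiffAt)]
      rw [pd_congr hev, pd_add (hwd.fun_mul (hflD a)) (hDd.fun_mul (hflw a)), pd_mul hwd (hflD a),
        pd_mul hDd (hflw a)]
    have e := heq x hx
    rw [lap_eq_flux, lap_eq_flux, hprod, hprod] at e
    have hD'x : D' x = w x * D x := congrFun hwD x
    rw [hD'x] at e
    have e1 : pd 0 w x * flux g D 0 x + pd 1 w x * flux g D 1 x + pd 0 D x * flux g w 0 x
        + pd 1 D x * flux g w 1 x + D x * (pd 0 (flux g w 0) x + pd 1 (flux g w 1) x) = 0 := by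
      field_simp at e
      linarith
    have hNd : ∀ i j, DifferentiableAt ℝ (N i j) x := fun i j => hdf (hNs i j).contDiffAt
    have hpw : ∀ i, DifferentiableAt ℝ (pd i w) x := fun i => hdf (hws x hx).pd
    simp only [hc₀, hc₁]
    simp only [hfx, hfy] at e1 ⊢
    rw [pd_sub ((hNd _ _).fun_mul (hpw _)) ((hNd _ _).fun_mul (hpw _)),
      pd_sub ((hNd _ _).fun_mul (hpw _)) ((hNd _ _).fun_mul (hpw _)), pd_mul (hNd _ _) (hpw _),
      pd_mul (hNd _ _) (hpw _), pd_mul (hNd _ _) (hpw _), pd_mul (hNd _ _) (hpw _),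
      pd_comm (hws x hx) 1 0] at e1
    field_simp
    linarith
  have hapos : ∀ x, 0 < N 1 1 x := fun x =>
    div_pos (hgpos x).diag_pos (Real.sqrt_pos.2 (hgpos x).det_pos)
  have hdet : ∀ x, 0 < N 1 1 x * N 0 0 x - -N 0 1 x * -N 0 1 x := fun x => by
    have hd := (hgpos x).det_pos
    have hs := Real.sqrt_pos.2 hd
    have : N 1 1 x * N 0 0 x - -N 0 1 x * -N 0 1 x = (g x).det / (Real.sqrt (g x).det
        * Real.sqrt (g x).det) := by
      simp only [hN]
      field_simp
      rw [Matrix.det_fin_two, hsym]; ring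
    rw [this]
    positivity
  have hc₀c : Continuous c₀ := by
    have hfl : Continuous (flux g D 0) := by
      rw [hfx]
      exact (((hNs _ _).mul hD.pd).sub ((hNs _ _).mul hD.pd)).continuous
    exact ((hNs _ _).pd.continuous.sub (hNs _ _).pd.continuous).add
      ((continuous_const.mul hfl).div hD.continuous fun x => (hDpos x).ne')
  have hwbd : ∀ x ∈ frontier Ω, w x = 1 := fun x hx => by
    simp [hw, hbd x hx, (hDpos x).ne']
  have hle := weak_maximum_principle hΩ hΩb (hNs 1 1).continuous hc₀c hapos hdet hwc hws hpde
    fun x hx => (hwbd x hx).le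
  have hge := weak_maximum_principle (w := fun x => -w x) (m := -1) (c₁ := c₁)
    hΩ hΩb (hNs 1 1).continuous hc₀c hapos hdet hwc.neg (fun x hx => (hws x hx).neg) (fun x hx => by
      have hpn : ∀ i, pd i (fun y => -w y) = fun y => -pd i w y := fun i => funext fun y => pd_neg
      simp only [hpn, pd_neg]
      linarith [hpde x hx]) fun x hx => by simp [hwbd x hx]
  intro x hx
  have h1 : w x = 1 := le_antisymm (hle x hx) (by linarith [hge x hx])
  rw [hwD]; simp [h1]

theorem stmt11 (Ω : Set (Fin 2 → ℝ)) (hΩopen : IsOpen Ω) (hΩconn : IsConnected Ω)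
    (hΩbdd : Bornology.IsBounded Ω)
    (g gt : (Fin 2 → ℝ) → Matrix (Fin 2) (Fin 2) ℝ)
    (hg : ∀ i j, ContDiff ℝ (⊤ : ℕ∞) (fun x => g x i j))
    (hgt : ∀ i j, ContDiff ℝ (⊤ : ℕ∞) (fun x => gt x i j))
    (hgpos : ∀ x, (g x).PosDef) (hgtpos : ∀ x, (gt x).PosDef)
    (φ : (Fin 2 → ℝ) → (Fin 2 → ℝ)) (hφ : ContDiffOn ℝ (⊤ : ℕ∞) φ (closure Ω))
    (hφbij : Set.BijOn φ Ω Ω) (hφbd : ∀ x ∈ frontier Ω, φ x = x)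
    (lam : (Fin 2 → ℝ) → ℝ) (hlam : ∀ x, 0 < lam x)
    (hlambd : ∀ x ∈ frontier Ω, lam x = 1)
    -- g = λ φ* g̃ :
    (hpull : ∀ x ∈ Ω, g x = lam x • ((jac φ x)ᵀ * gt (φ x) * jac φ x))
    -- det(g⁻¹ · g̃∘φ) = 1 to first order on ∂Ω :
    (hbd0 : ∀ x ∈ frontier Ω, ((g x)⁻¹ * gt (φ x)).det = 1)
    (hbd1 : ∀ x ∈ frontier Ω,
      fderiv ℝ (fun y => ((g y)⁻¹ * gt (φ y)).det) x = 0)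
    -- q = λ⁻¹ φ* q̃ :
    (hq : ∀ x ∈ Ω, pot g x = (lam x)⁻¹ * pot gt (φ x)) :
    ∀ x ∈ Ω, (jac φ x).det * lam x = 1 := by
  have hsub : ∀ x ∈ Ω, closure Ω ∈ 𝓝 x := fun x hx =>
    Filter.mem_of_superset (hΩopen.mem_nhds hx) subset_closure
  have hφs : ∀ x ∈ Ω, ContDiffAt ℝ ∞ φ x := fun x hx => hφ.contDiffAt (hsub x hx)
  have hdetg : ∀ x ∈ Ω, (g x).det = (lam x * (jac φ x).det) ^ 2 * (gt (φ x)).det := fun x hx => by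
    rw [hpull x hx, det_conformal_pullback]
  have hJ0 : ∀ x ∈ Ω, (jac φ x).det ≠ 0 := fun x hx h => by
    have := (hgpos x).det_pos
    rw [hdetg x hx, h] at this
    simp at this
  have hJc : ContinuousOn (fun x => (jac φ x).det) Ω := fun x hx => by
    have h : ∀ i j, ContinuousAt (pd i (fun y => φ y j)) x := fun i j =>
      (contDiffAt_pi.1 (hφs x hx) j).pd.continuousAt
    simp only [jac_det]
    exact (((h _ _).mul (h _ _)).sub ((h _ _).mul (h _ _))).continuousWithinAt
  have hJ : ∀ x ∈ Ω, 0 < (jac φ x).det := fun x hx => by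
    obtain ⟨z, hz, hzpos⟩ := exists_jac_det_pos_of_eq_on_frontier hΩopen hΩbdd hΩconn.nonempty
      hφ.continuousOn hφs hφbd
    by_contra! hneg
    obtain ⟨y, hy, hy0⟩ := hΩconn.isPreconnected.intermediate_value hx hz hJc ⟨hneg, hzpos.le⟩
    exact hJ0 y hy hy0
  have hpow : ∀ {h : (Fin 2 → ℝ) → Matrix (Fin 2) (Fin 2) ℝ},
      (∀ i j, ContDiff ℝ ∞ (fun x => h x i j)) → (∀ x, (h x).PosDef) →
      ContDiff ℝ ∞ (fun x => (h x).det ^ (-(1 : ℝ) / 4)) := fun hh hpos =>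
    (contDiff_det hh).rpow_const_of_ne fun x => (hpos x).det_pos.ne'
  have hDs := hpow hg hgpos
  have hfs := hpow hgt hgtpos
  have hDpos : ∀ x, 0 < (g x).det ^ (-(1 : ℝ) / 4) := fun x =>
    Real.rpow_pos_of_pos (hgpos x).det_pos _
  have hfpos : ∀ x, 0 < (gt x).det ^ (-(1 : ℝ) / 4) := fun x =>
    Real.rpow_pos_of_pos (hgtpos x).det_pos _
  have hinv : ∀ {t : ℝ}, 0 < t → t ^ ((1 : ℝ) / 4) = (t ^ (-(1 : ℝ) / 4))⁻¹ := fun ht => by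
    rw [← Real.rpow_neg ht.le]; norm_num
  have hclear : ∀ {a b l p q : ℝ}, 0 < a → 0 < b → 0 < l → a⁻¹ * p = l⁻¹ * (b⁻¹ * q) →
      b * p = a * (l⁻¹ * q) := fun ha hb hl h => by
    field_simp at h ⊢
    linarith
  have hagree := eq_of_mul_lap_eq_mul_lap hΩopen hΩbdd hg hgpos hDs hDpos
    (D' := fun x => (gt (φ x)).det ^ (-(1 : ℝ) / 4))
    (fun x hx => hfs.contDiffAt.comp x (hφs x hx))
    (hfs.continuous.comp_continuousOn hφ.continuousOn)
    (fun x hx => by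
      have h := hq x hx
      rw [pot, pot, hinv (hgpos x).det_pos, hinv (hgtpos (φ x)).det_pos] at h
      rw [lap_conformal_pullback hΩopen hgt hgtpos hφs hlam hJ hpull
        (f := fun y => (gt y).det ^ (-(1 : ℝ) / 4)) hfs hx]
      exact hclear (hDpos x) (hfpos (φ x)) (hlam x) h)
    (fun x hx => by
      have h := hbd0 x hx
      rw [Matrix.det_mul, Matrix.det_nonsing_inv, Ring.inverse_eq_inv',
        inv_mul_eq_one₀ (hgpos x).det_pos.ne'] at h
      simp only [h])
  intro x hx
  have h1 : (gt (φ x)).det = (g x).det :=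
    (Real.rpow_left_inj (hgtpos _).det_pos.le (hgpos x).det_pos.le (by norm_num)).1 (hagree x hx)
  have h2 := hdetg x hx
  rw [h1] at h2
  have h3 : (lam x * (jac φ x).det) ^ 2 = 1 :=
    mul_right_cancel₀ (hgpos x).det_pos.ne' (by rw [one_mul]; exact h2.symm)
  rw [mul_comm]
  exact (pow_eq_one_iff_of_nonneg (mul_pos (hlam x) (hJ x hx)).le two_ne_zero).1 h3
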